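/- The function Ψ satisfies: for any 0 < r ≤ R, (1/81)·(R/r)^{β₀} ≤ Ψ(R)/Ψ(r) ≤ 81·(R/r)^{β₁}. -/

import Mathlib

open scoped BigOperators ENNReal
open Set Filter MeasureTheory

noncomputable section

abbrev E2 : Type := EuclideanSpace ℝ (Fin 2)

/-- The index set `S_l` of the level-`l` thin Sierpinski gasket. -/
def Sset (l : ℕ) : Set (ℕ × ℕ) :=
  {p | p.1 + p.2 ≤ l - 1 ∧ p.1 * p.2 * (l - 1 - p.1 - p.2) = 0}

/-- The contraction `f^l_i`. -/
def fmap (q : Fin 3 → E2) (l : ℕ) (i : ℕ × ℕ) (x : E2) : E2 :=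
  q 0 + ((i.1 : ℝ) / l) • (q 1 - q 0) + ((i.2 : ℝ) / l) • (q 2 - q 0)
    + (l : ℝ)⁻¹ • (x - q 0)

/-- The closed equilateral triangle `△`. -/
def Tri (q : Fin 3 → E2) : Set E2 := convexHull ℝ (Set.range q)

def V0 (q : Fin 3 → E2) : Set E2 := Set.range q

/-- Words of length `n` (padded by `(0,0)` beyond position `n`). -/
def Wn (l : ℕ → ℕ) (n : ℕ) : Set (ℕ → ℕ × ℕ) :=
  {w | (∀ k, k < n → w k ∈ Sset (l k)) ∧ ∀ k, n ≤ k → w k = (0, 0)}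

/-- `wordMap q l w n = f^{l_1}_{w_1} ∘ ⋯ ∘ f^{l_n}_{w_n}` (0-indexed). -/
def wordMap (q : Fin 3 → E2) (l : ℕ → ℕ) (w : ℕ → ℕ × ℕ) : ℕ → E2 → E2
  | 0 => id
  | n + 1 => wordMap q l w n ∘ fmap q (l n) (w n)

/-- The thin scale irregular Sierpinski gasket `K`. -/
def Gasket (q : Fin 3 → E2) (l : ℕ → ℕ) : Set E2 :=
  ⋂ n, ⋃ w ∈ Wn l n, wordMap q l w n '' Tri q

/-- The cell `K_w = K ∩ f_w(△)`. -/
def Cell (q : Fin 3 → E2) (l : ℕ → ℕ) (n : ℕ) (w : ℕ → ℕ × ℕ) : Set E2 :=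
  Gasket q l ∩ wordMap q l w n '' Tri q

def Vn (q : Fin 3 → E2) (l : ℕ → ℕ) (n : ℕ) : Set E2 :=
  ⋃ w ∈ Wn l n, wordMap q l w n '' V0 q

def Vstar (q : Fin 3 → E2) (l : ℕ → ℕ) : Set E2 := ⋃ n, Vn q l n

def Ln (l : ℕ → ℕ) (n : ℕ) : ℕ := ∏ k ∈ Finset.range n, l k

def Mn (l : ℕ → ℕ) (n : ℕ) : ℕ := ∏ k ∈ Finset.range n, (3 * l k - 3)

def rl (l : ℕ) : ℝ := (2 * (l : ℝ) / 3 + 1 / 9)⁻¹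

def Rn (l : ℕ → ℕ) (n : ℕ) : ℝ := ∏ k ∈ Finset.range n, rl (l k)

def Tn (l : ℕ → ℕ) (n : ℕ) : ℝ := (Mn l n : ℝ) / Rn l n

/-- The basic energy form `E⁰` on `ℝ^{V₀}`. -/
def E0 (q : Fin 3 → E2) (u v : E2 → ℝ) : ℝ :=
  (1 / 2) * ∑ j : Fin 3, ∑ k : Fin 3, (u (q j) - u (q k)) * (v (q j) - v (q k))

/-- The level-`n` energy form `Eⁿ`. -/
def En (q : Fin 3 → E2) (l : ℕ → ℕ) (n : ℕ) (u v : E2 → ℝ) : ℝ :=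
  (Rn l n)⁻¹ * ∑ᶠ w ∈ Wn l n, E0 q (u ∘ wordMap q l w n) (v ∘ wordMap q l w n)

/-- The domain `F` of the limit resistance form. -/
def FDom (q : Fin 3 → E2) (l : ℕ → ℕ) : Set (E2 → ℝ) :=
  {u | ∃ C : ℝ, ∀ n, En q l n u u ≤ C}

/-- The limit form `E(u,v) = lim_n Eⁿ(u,v)`. -/
def EForm (q : Fin 3 → E2) (l : ℕ → ℕ) (u v : E2 → ℝ) : ℝ :=
  limUnder atTop fun n => En q l n u v

/-- The intrinsic (geodesic) distance on `K`, with values in `ℝ≥0∞`. -/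
def pdist (q : Fin 3 → E2) (l : ℕ → ℕ) (x y : E2) : ℝ≥0∞ :=
  ⨅ (γ : ℝ → E2) (_ : ContinuousOn γ (Set.Icc 0 1))
    (_ : Set.MapsTo γ (Set.Icc 0 1) (Gasket q l)) (_ : γ 0 = x) (_ : γ 1 = y),
    eVariationOn γ (Set.Icc 0 1)

def gdist (q : Fin 3 → E2) (l : ℕ → ℕ) (x y : E2) : ℝ := (pdist q l x y).toReal

/-- The set of resistance quotients used to define `R_E`. -/
def REset (q : Fin 3 → E2) (l : ℕ → ℕ) (x y : E2) : Set ℝ :=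
  {t | ∃ u ∈ FDom q l, 0 < EForm q l u u ∧ t = (u x - u y) ^ 2 / EForm q l u u}

/-- The resistance metric `R_E`. -/
def RE (q : Fin 3 → E2) (l : ℕ → ℕ) (x y : E2) : ℝ := sSup (REset q l x y)

/-- Resistance quotients over continuous representatives (i.e. `F` viewed in `C(K)`). -/
def REcSet (q : Fin 3 → E2) (l : ℕ → ℕ) (x y : E2) : Set ℝ :=
  {t | ∃ u ∈ FDom q l, ContinuousOn u (Gasket q l) ∧ 0 < EForm q l u u ∧
    t = (u x - u y) ^ 2 / EForm q l u u}

def REc (q : Fin 3 → E2) (l : ℕ → ℕ) (x y : E2) : ℝ := sSup (REcSet q l x y)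

/-- The open `d`-ball in `K`. -/
def Bd (q : Fin 3 → E2) (l : ℕ → ℕ) (x : E2) (s : ℝ) : Set E2 :=
  {y ∈ Gasket q l | gdist q l x y < s}

/-- The open `R_E`-ball in `K`. -/
def BRc (q : Fin 3 → E2) (l : ℕ → ℕ) (x : E2) (s : ℝ) : Set E2 :=
  {y ∈ Gasket q l | REc q l x y < s}

/-- `Λ^{(k)}_{n,w}`: words within `k` cell-steps of `w`. -/
def Lam (q : Fin 3 → E2) (l : ℕ → ℕ) (n : ℕ) (w : ℕ → ℕ × ℕ) (k : ℕ) :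
    Set (ℕ → ℕ × ℕ) :=
  {v ∈ Wn l n | ∃ c : ℕ → ℕ → ℕ × ℕ, c 0 = w ∧ c k = v ∧ (∀ j ≤ k, c j ∈ Wn l n) ∧
    ∀ j < k, (Cell q l n (c j) ∩ Cell q l n (c (j + 1))).Nonempty}

/-- `U^{(k)}_{n,w}`. -/
def Unwk (q : Fin 3 → E2) (l : ℕ → ℕ) (n : ℕ) (w : ℕ → ℕ × ℕ) (k : ℕ) : Set E2 :=
  ⋃ v ∈ Lam q l n w k, Cell q l n v

def betaZero (l : ℕ → ℕ) : ℝ :=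
  ⨅ n : ℕ, Real.logb (l n) (2 * (l n : ℝ) ^ 2 - (5 / 3) * (l n : ℝ) - 1 / 3)

def betaOne (l : ℕ → ℕ) : ℝ :=
  ⨆ n : ℕ, Real.logb (l n) (2 * (l n : ℝ) ^ 2 - (5 / 3) * (l n : ℝ) - 1 / 3)

def betaM (l : ℕ → ℕ) : ℝ := ⨅ n : ℕ, Real.logb (l n) (3 * (l n : ℝ) - 3)

def betaR (l : ℕ → ℕ) : ℝ := ⨆ n : ℕ, Real.logb (l n) ((rl (l n))⁻¹)

/-- The value of `Ψ` on the interval `[1/L_{n+1}, 1/L_n]`. -/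
def psiPiece (l : ℕ → ℕ) (n : ℕ) (s : ℝ) : ℝ :=
  (Tn l (n + 1))⁻¹
    * (1 + ((3 * (l n : ℝ) - 4) / ((l n : ℝ) - 1)) * ((Ln l (n + 1) : ℝ) * s - 1))
    * (1 + (((2 / 3) * (l n : ℝ) - 8 / 9) / ((l n : ℝ) - 1)) * ((Ln l (n + 1) : ℝ) * s - 1))

/-- `Ψ = Ψ_𝒍` is characterized by these defining clauses. -/
def IsPsi (l : ℕ → ℕ) (Psi : ℝ → ℝ) : Prop :=
  (∀ n : ℕ, ∀ s : ℝ, ((Ln l (n + 1) : ℝ))⁻¹ ≤ s → s ≤ ((Ln l n : ℝ))⁻¹ →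
      Psi s = psiPiece l n s) ∧
  (∀ s : ℝ, 1 ≤ s → Psi s = s ^ betaZero l) ∧ Psi 0 = 0

def psiMPiece (l : ℕ → ℕ) (n : ℕ) (s : ℝ) : ℝ :=
  ((Mn l (n + 1) : ℝ))⁻¹
    * (1 + ((3 * (l n : ℝ) - 4) / ((l n : ℝ) - 1)) * ((Ln l (n + 1) : ℝ) * s - 1))

def IsPsiM (l : ℕ → ℕ) (PsiM : ℝ → ℝ) : Prop :=
  (∀ n : ℕ, ∀ s : ℝ, ((Ln l (n + 1) : ℝ))⁻¹ ≤ s → s ≤ ((Ln l n : ℝ))⁻¹ →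
      PsiM s = psiMPiece l n s) ∧
  (∀ s : ℝ, 1 ≤ s → PsiM s = s ^ betaM l) ∧ PsiM 0 = 0

def psiRPiece (l : ℕ → ℕ) (n : ℕ) (s : ℝ) : ℝ :=
  Rn l (n + 1)
    * (1 + (((2 / 3) * (l n : ℝ) - 8 / 9) / ((l n : ℝ) - 1)) * ((Ln l (n + 1) : ℝ) * s - 1))

def IsPsiR (l : ℕ → ℕ) (PsiR : ℝ → ℝ) : Prop :=
  (∀ n : ℕ, ∀ s : ℝ, ((Ln l (n + 1) : ℝ))⁻¹ ≤ s → s ≤ ((Ln l n : ℝ))⁻¹ →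
      PsiR s = psiRPiece l n s) ∧
  (∀ s : ℝ, 1 ≤ s → PsiR s = s ^ betaR l) ∧ PsiR 0 = 0

/-- `μ` is the uniform distribution on `K`: a Borel measure carried by `K`
with `μ(K_w) = 1/M_{|w|}` for every word `w`. -/
def IsUnif (q : Fin 3 → E2) (l : ℕ → ℕ) (μ : Measure E2) : Prop :=
  μ (Gasket q l)ᶜ = 0 ∧ ∀ n : ℕ, ∀ w ∈ Wn l n, μ (Cell q l n w) = ((Mn l n : ℝ≥0∞))⁻¹

/-- `μ` is the energy measure of `u`: a Borel measure carried by `K` with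
`μ(K_w) = R_{|w|}⁻¹ E^{𝒍^{|w|}}(u∘F_w, u∘F_w)` for every word `w`. -/
def IsEnergyMeasure (q : Fin 3 → E2) (l : ℕ → ℕ) (u : E2 → ℝ) (μ : Measure E2) : Prop :=
  μ (Gasket q l)ᶜ = 0 ∧ ∀ n : ℕ, ∀ w ∈ Wn l n,
    μ (Cell q l n w) = ENNReal.ofReal ((Rn l n)⁻¹ *
      EForm q (fun k => l (k + n)) (u ∘ wordMap q l w n) (u ∘ wordMap q l w n))


def tauP (l : ℕ) : ℝ := 2 * (l : ℝ) ^ 2 - (5 / 3) * (l : ℝ) - 1 / 3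

def betaP (l : ℕ) : ℝ := Real.logb (l : ℝ) (tauP l)

theorem castP (l : ℕ) (h : 5 ≤ l) : (5 : ℝ) ≤ l := by exact_mod_cast h

theorem tauP_lo (l : ℕ) (h : 5 ≤ l) : (l : ℝ) ^ 2 ≤ tauP l := by
  have := castP l h
  unfold tauP; nlinarith

theorem tauP_hi (l : ℕ) (h : 5 ≤ l) : tauP l ≤ 2 * (l : ℝ) ^ 2 := by
  have := castP l h
  unfold tauP; nlinarith

theorem tauP_pos (l : ℕ) (h : 5 ≤ l) : 0 < tauP l := by
  have := castP l h
  have := tauP_lo l h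
  nlinarith

theorem rpow_betaP (l : ℕ) (h : 5 ≤ l) : (l : ℝ) ^ betaP l = tauP l := by
  have := castP l h
  exact Real.rpow_logb (by linarith) (by linarith) (tauP_pos l h)

theorem betaP_ge (l : ℕ) (h : 5 ≤ l) : 2 ≤ betaP l := by
  have h5 := castP l h
  unfold betaP
  rw [Real.le_logb_iff_rpow_le (by linarith) (tauP_pos l h)]
  have := tauP_lo l h
  exact_mod_cast this

theorem betaP_le (l : ℕ) (h : 5 ≤ l) : betaP l ≤ 3 := by
  have h5 := castP l h
  unfold betaP
  rw [Real.logb_le_iff_le_rpow (by linarith) (tauP_pos l h)]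
  have h1 := tauP_hi l h
  have : tauP l ≤ (l : ℝ) ^ 3 := by nlinarith [sq_nonneg (l : ℝ)]
  exact_mod_cast this

theorem betaZero_le (l : ℕ → ℕ) (hl : ∀ n, 5 ≤ l n) (n : ℕ) : betaZero l ≤ betaP (l n) := by
  refine ciInf_le (f := fun n => betaP (l n)) ⟨2, ?_⟩ n
  rintro _ ⟨k, rfl⟩
  exact betaP_ge _ (hl k)

theorem le_betaOne (l : ℕ → ℕ) (hl : ∀ n, 5 ≤ l n) (n : ℕ) : betaP (l n) ≤ betaOne l := by
  refine le_ciSup (f := fun n => betaP (l n)) ⟨3, ?_⟩ n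
  rintro _ ⟨k, rfl⟩
  exact betaP_le _ (hl k)

theorem Ln_pos (l : ℕ → ℕ) (hl : ∀ n, 5 ≤ l n) (n : ℕ) : (0 : ℝ) < Ln l n := by
  have : 0 < Ln l n := Finset.prod_pos fun k _ => by have := hl k; omega
  exact_mod_cast this

theorem Ln_succ (l : ℕ → ℕ) (n : ℕ) : (Ln l (n + 1) : ℝ) = Ln l n * l n := by
  simp [Ln, Finset.prod_range_succ]

theorem Tn_succ (l : ℕ → ℕ) (hl : ∀ n, 5 ≤ l n) (n : ℕ) :
    Tn l (n + 1) = Tn l n * tauP (l n) := by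
  have h5 := castP _ (hl n)
  have h1 : (Mn l (n + 1) : ℝ) = Mn l n * (3 * (l n : ℝ) - 3) := by
    have : 3 ≤ 3 * l n := by have := hl n; omega
    simp [Mn, Finset.prod_range_succ, Nat.cast_sub this]
  have h2 : Rn l (n + 1) = Rn l n * rl (l n) := by simp [Rn, Finset.prod_range_succ]
  unfold Tn
  rw [h1, h2, mul_div_mul_comm]
  congr 1
  unfold rl tauP
  rw [div_inv_eq_mul]; ring

theorem Tn_zero (l : ℕ → ℕ) : Tn l 0 = 1 := by simp [Tn, Mn, Rn]

theorem Tn_pos (l : ℕ → ℕ) (hl : ∀ n, 5 ≤ l n) (n : ℕ) : 0 < Tn l n := by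
  induction n with
  | zero => simp [Tn_zero]
  | succ k ih => rw [Tn_succ l hl]; exact mul_pos ih (tauP_pos _ (hl k))

theorem Ln_mono (l : ℕ → ℕ) (hl : ∀ n, 5 ≤ l n) : Monotone fun n => (Ln l n : ℝ) := by
  refine monotone_nat_of_le_succ fun n => ?_
  have := Ln_pos l hl n
  have := castP _ (hl n)
  simp only [Ln_succ]
  nlinarith

/-- `s` is in the `n`-th half-open piece and `g` is the model power function at `s`. -/
def InPiece (l : ℕ → ℕ) (n : ℕ) (s g : ℝ) : Prop :=
  1 ≤ Ln l (n + 1) * s ∧ Ln l n * s < 1 ∧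
    g = (Ln l (n + 1) * s) ^ betaP (l n) / Tn l (n + 1)

def DD (l : ℕ → ℕ) (n : ℕ) (s g : ℝ) : Prop :=
  1 ≤ Ln l n * s ∧ (Ln l n * s) ^ betaZero l ≤ g * Tn l n ∧
    g * Tn l n ≤ (Ln l n * s) ^ betaOne l

theorem rpow_sandwich (l : ℕ → ℕ) (hl : ∀ n, 5 ≤ l n) (n : ℕ) (x : ℝ) (hx : 1 ≤ x) :
    x ^ betaZero l ≤ x ^ betaP (l n) ∧ x ^ betaP (l n) ≤ x ^ betaOne l :=
  ⟨Real.rpow_le_rpow_of_exponent_le hx (betaZero_le l hl n),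
    Real.rpow_le_rpow_of_exponent_le hx (le_betaOne l hl n)⟩

theorem DD_succ (l : ℕ → ℕ) (hl : ∀ n, 5 ≤ l n) (n : ℕ) (s g : ℝ) (h : DD l n s g) :
    DD l (n + 1) s g := by
  obtain ⟨h1, h2, h3⟩ := h
  have h5 := castP _ (hl n)
  have hs := rpow_sandwich l hl n (l n) (by linarith)
  rw [rpow_betaP _ (hl n)] at hs
  have hL : (Ln l (n + 1) : ℝ) * s = (Ln l n * s) * l n := by rw [Ln_succ]; ring
  have hT : g * Tn l (n + 1) = (g * Tn l n) * tauP (l n) := by rw [Tn_succ l hl]; ring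
  have hp := tauP_pos _ (hl n)
  have h0 : (0 : ℝ) ≤ Ln l n * s := by linarith
  have hl0 : (0 : ℝ) ≤ l n := by linarith
  refine ⟨by rw [hL]; nlinarith, ?_, ?_⟩
  · rw [hL, hT, Real.mul_rpow h0 hl0]
    exact mul_le_mul h2 hs.1 (by positivity) (le_trans (by positivity) h2)
  · rw [hL, hT, Real.mul_rpow h0 hl0]
    exact mul_le_mul h3 hs.2 hp.le (by positivity)

theorem DD_of_le (l : ℕ → ℕ) (hl : ∀ n, 5 ≤ l n) (n m : ℕ) (hnm : n ≤ m) (s g : ℝ)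
    (h : DD l n s g) : DD l m s g := by
  induction m, hnm using Nat.le_induction with
  | base => exact h
  | succ k _ ih => exact DD_succ l hl k s g ih

theorem InPiece.DD {l : ℕ → ℕ} (hl : ∀ n, 5 ≤ l n) {n : ℕ} {s g : ℝ}
    (h : InPiece l n s g) : DD l (n + 1) s g := by
  obtain ⟨h1, _, rfl⟩ := h
  refine ⟨h1, ?_⟩
  rw [div_mul_cancel₀ _ (Tn_pos l hl _).ne']
  exact rpow_sandwich l hl n _ h1

theorem DD_big (l : ℕ → ℕ) (hl : ∀ n, 5 ≤ l n) (s : ℝ) (hs : 1 ≤ s) :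
    DD l 0 s (s ^ betaZero l) := by
  have := rpow_sandwich l hl 0 s hs
  simpa [DD, Tn_zero, Ln, hs] using this.1.trans this.2

theorem InPiece.pos {l : ℕ → ℕ} (hl : ∀ n, 5 ≤ l n) {n : ℕ} {s g : ℝ}
    (h : InPiece l n s g) : 0 < g := by
  obtain ⟨h1, _, rfl⟩ := h
  have := Tn_pos l hl (n + 1)
  have : 0 < (Ln l (n + 1) : ℝ) * s := by linarith
  positivity

/-- combine across a boundary point -/
theorem cross (l : ℕ → ℕ) (hl : ∀ n, 5 ≤ l n) (n : ℕ) (r R g G : ℝ)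
    (h : InPiece l n r g) (H : DD l n R G) :
    (R / r) ^ betaZero l ≤ G / g ∧ G / g ≤ (R / r) ^ betaOne l := by
  have hg := h.pos hl
  obtain ⟨h1, h2, hgd⟩ := h
  obtain ⟨H1, H2, H3⟩ := H
  have hLn := Ln_pos l hl n
  have hLn1 := Ln_pos l hl (n + 1)
  have hT := Tn_pos l hl n
  have hT1 := Tn_pos l hl (n + 1)
  have hr : 0 < r := by
    by_contra hc; nlinarith [mul_nonneg hLn1.le (by linarith : 0 ≤ -r)]
  have h5 := castP _ (hl n)
  set y : ℝ := (Ln l n * r)⁻¹ with hy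
  have hy1 : 1 ≤ y := by
    rw [hy]; exact (one_le_inv₀ (by positivity)).2 h2.le
  have hs := rpow_sandwich l hl n y hy1
  have e1 : R / r = (Ln l n * R) * y := by rw [hy]; field_simp
  have e2 : G / g = (G * Tn l n) * y ^ betaP (l n) := by
    have hx : (Ln l (n + 1) : ℝ) * r = l n * y⁻¹ := by rw [hy, inv_inv, Ln_succ]; ring
    rw [hgd, hx, Real.mul_rpow (by linarith) (by positivity), rpow_betaP _ (hl n),
      Tn_succ l hl, Real.inv_rpow (by linarith)]
    have := tauP_pos _ (hl n)
    have : 0 < y ^ betaP (l n) := by positivity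
    field_simp
  have h0 : (0 : ℝ) ≤ Ln l n * R := by linarith
  have hy0 : 0 ≤ y := by linarith
  rw [e1, e2, Real.mul_rpow h0 hy0, Real.mul_rpow h0 hy0]
  constructor
  · exact mul_le_mul H2 hs.1 (by positivity) (le_trans (by positivity) H2)
  · exact mul_le_mul H3 hs.2 (by positivity) (by positivity)

theorem same (l : ℕ → ℕ) (hl : ∀ n, 5 ≤ l n) (n : ℕ) (r R g G : ℝ) (hr : 0 < r) (hrR : r ≤ R)
    (h : InPiece l n r g) (H : InPiece l n R G) :
    (R / r) ^ betaZero l ≤ G / g ∧ G / g ≤ (R / r) ^ betaOne l := by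
  obtain ⟨h1, h2, rfl⟩ := h
  obtain ⟨H1, H2, rfl⟩ := H
  have hLn1 := Ln_pos l hl (n + 1)
  have hT1 := Tn_pos l hl (n + 1)
  rw [div_div_div_cancel_right₀ hT1.ne', ← Real.div_rpow (by linarith) (by linarith),
    mul_div_mul_left _ _ hLn1.ne']
  exact rpow_sandwich l hl n _ ((one_le_div hr).2 hrR)

theorem exists_piece (l : ℕ → ℕ) (hl : ∀ n, 5 ≤ l n) (s : ℝ) (h0 : 0 < s) (h1 : s < 1) :
    ∃ n g, InPiece l n s g := by
  have hex : ∃ n, 1 ≤ (Ln l n : ℝ) * s := by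
    obtain ⟨n, hn⟩ := pow_unbounded_of_one_lt (1 / s) (by norm_num : (1 : ℝ) < 5)
    refine ⟨n, ?_⟩
    have : (5 : ℝ) ^ n ≤ Ln l n := by
      have : 5 ^ n ≤ Ln l n := by
        have := Finset.prod_le_prod' (s := Finset.range n) (f := fun _ => 5) (g := l)
          (fun k _ => hl k)
        simpa [Ln] using this
      exact_mod_cast this
    rw [div_lt_iff₀ h0] at hn
    nlinarith
  classical
  obtain ⟨N, hN⟩ : ∃ N, N = Nat.find hex := ⟨_, rfl⟩
  have hs := Nat.find_spec hex
  rw [← hN] at hs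
  cases N with
  | zero => simp [Ln] at hs; linarith
  | succ k =>
    have := Nat.find_min hex (m := k) (by omega)
    exact ⟨k, _, hs, not_le.1 this, rfl⟩

theorem psi_comp (l : ℕ → ℕ) (hl : ∀ n, 5 ≤ l n) (Psi : ℝ → ℝ) (hPsi : IsPsi l Psi)
    (n : ℕ) (s g : ℝ) (h : InPiece l n s g) : g / 9 ≤ Psi s ∧ Psi s ≤ 9 * g := by
  obtain ⟨h1, h2, rfl⟩ := h
  have hLn := Ln_pos l hl n
  have hLn1 := Ln_pos l hl (n + 1)
  have hT1 := Tn_pos l hl (n + 1)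
  have h5 := castP _ (hl n)
  rw [hPsi.1 n s (by rw [inv_le_iff_one_le_mul₀' hLn1]; exact h1)
    (by rw [le_inv_comm₀ (by by_contra hc; nlinarith) hLn, ← one_div, le_div_iff₀ (by by_contra hc; nlinarith)]; exact h2.le)]
  have htl : (Ln l (n + 1) : ℝ) * s ≤ l n := by rw [Ln_succ]; nlinarith
  unfold psiPiece
  generalize (Ln l (n + 1) : ℝ) * s = t at *
  have ht0 : 0 < t := by linarith
  have hA1 : 1 ≤ (3 * (l n : ℝ) - 4) / ((l n : ℝ) - 1) := by
    rw [le_div_iff₀ (by linarith)]; linarith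
  have hA2 : (3 * (l n : ℝ) - 4) / ((l n : ℝ) - 1) ≤ 3 := by
    rw [div_le_iff₀ (by linarith)]; linarith
  have hB1 : 1 / 2 ≤ ((2 / 3) * (l n : ℝ) - 8 / 9) / ((l n : ℝ) - 1) := by
    rw [le_div_iff₀ (by linarith)]; linarith
  have hB2 : ((2 / 3) * (l n : ℝ) - 8 / 9) / ((l n : ℝ) - 1) ≤ 1 := by
    rw [div_le_iff₀ (by linarith)]; linarith
  generalize (3 * (l n : ℝ) - 4) / ((l n : ℝ) - 1) = A at *
  generalize ((2 / 3) * (l n : ℝ) - 8 / 9) / ((l n : ℝ) - 1) = B at *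
  have a1 : t ≤ 1 + A * (t - 1) := by nlinarith
  have a2 : 1 + A * (t - 1) ≤ 3 * t := by nlinarith
  have b1 : t / 2 ≤ 1 + B * (t - 1) := by nlinarith
  have b2 : 1 + B * (t - 1) ≤ t := by nlinarith
  have hb := betaP_ge _ (hl n)
  have p1 : t ^ 2 ≤ t ^ betaP (l n) := by
    have := Real.rpow_le_rpow_of_exponent_le h1 hb
    exact_mod_cast this
  have p2 : t ^ betaP (l n) ≤ 2 * t ^ 2 := by
    have e : ∀ x : ℝ, 0 < x → x ^ betaP (l n) = x ^ 2 * x ^ (betaP (l n) - 2) := by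
      intro x hx
      rw [← Real.rpow_natCast, ← Real.rpow_add hx]; congr 1; push_cast; ring
    have q1 : t ^ (betaP (l n) - 2) ≤ (l n : ℝ) ^ (betaP (l n) - 2) :=
      Real.rpow_le_rpow ht0.le htl (by linarith)
    have q2 : (l n : ℝ) ^ (betaP (l n) - 2) ≤ 2 := by
      have q3 := e (l n) (by linarith)
      rw [rpow_betaP _ (hl n)] at q3
      have q4 := tauP_hi _ (hl n)
      rw [q3, mul_comm] at q4
      exact le_of_mul_le_mul_right q4 (by positivity)
    rw [e t ht0]
    nlinarith [sq_nonneg t]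
  have m1 : t * (t / 2) ≤ (1 + A * (t - 1)) * (1 + B * (t - 1)) :=
    mul_le_mul a1 b1 (by linarith) (by linarith)
  have m2 : (1 + A * (t - 1)) * (1 + B * (t - 1)) ≤ 3 * t * t :=
    mul_le_mul a2 b2 (by linarith) (by linarith)
  rw [mul_assoc, inv_mul_eq_div, div_right_comm, ← mul_div_assoc]
  constructor
  · apply div_le_div_of_nonneg_right _ hT1.le
    nlinarith
  · apply div_le_div_of_nonneg_right _ hT1.le
    nlinarith

theorem finish9 (X Y p q g G : ℝ) (hg : 0 < g) (hG : 0 < G) (h1 : g / 9 ≤ p) (h2 : p ≤ 9 * g)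
    (H1 : G / 9 ≤ q) (H2 : q ≤ 9 * G) (h : X ≤ G / g ∧ G / g ≤ Y) :
    (1 / 81) * X ≤ q / p ∧ q / p ≤ 81 * Y := by
  have hp : 0 < p := by linarith
  constructor
  · have : (G / 9) / (9 * g) ≤ q / p := div_le_div₀ (by linarith) H1 hp h2
    have e : (G / 9) / (9 * g) = (1 / 81) * (G / g) := by field_simp; norm_num
    linarith [h.1]
  · have : q / p ≤ (9 * G) / (g / 9) := div_le_div₀ (by linarith) H2 (by linarith) h1
    have e : (9 * G) / (g / 9) = 81 * (G / g) := by field_simp; norm_num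
    linarith [h.2]

/-- `Ψ` satisfies `81⁻¹ (R/r)^{β₀} ≤ Ψ(R)/Ψ(r) ≤ 81 (R/r)^{β₁}`
for all `0 < r ≤ R`. -/
theorem stmt9 (l : ℕ → ℕ) (hl : ∀ n, 5 ≤ l n) (Psi : ℝ → ℝ) (hPsi : IsPsi l Psi) :
    ∀ r R : ℝ, 0 < r → r ≤ R →
      (1 / 81) * (R / r) ^ betaZero l ≤ Psi R / Psi r ∧
      Psi R / Psi r ≤ 81 * (R / r) ^ betaOne l := by
  intro r R hr hrR
  rcases lt_or_ge R 1 with hR1 | hR1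
  · obtain ⟨m, g, hg⟩ := exists_piece l hl r hr (by linarith)
    obtain ⟨n, G, hG⟩ := exists_piece l hl R (by linarith) hR1
    obtain ⟨c1, c2⟩ := psi_comp l hl Psi hPsi m r g hg
    obtain ⟨C1, C2⟩ := psi_comp l hl Psi hPsi n R G hG
    refine finish9 _ _ _ _ g G (hg.pos hl) (hG.pos hl) c1 c2 C1 C2 ?_
    rcases lt_trichotomy n m with hnm | hnm | hnm
    · exact cross l hl m r R g G hg (DD_of_le l hl (n + 1) m hnm R G (hG.DD hl))
    · subst hnm
      exact same l hl n r R g G hr hrR hg hG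
    · exfalso
      have h1 := hg.1
      have h2 := hG.2.1
      have h3 : (Ln l (m + 1) : ℝ) ≤ Ln l n := Ln_mono l hl hnm
      have h4 := mul_le_mul h3 hrR hr.le (Ln_pos l hl n).le
      linarith
  · have hPR := hPsi.2.1 R hR1
    have hGp : 0 < R ^ betaZero l := by
      have : 0 < R := by linarith
      positivity
    rcases lt_or_ge r 1 with hr1 | hr1
    · obtain ⟨m, g, hg⟩ := exists_piece l hl r hr hr1
      obtain ⟨c1, c2⟩ := psi_comp l hl Psi hPsi m r g hg
      refine finish9 _ _ _ _ g (R ^ betaZero l) (hg.pos hl) hGp c1 c2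
        (by rw [hPR]; linarith) (by rw [hPR]; linarith) ?_
      exact cross l hl m r R g _ hg (DD_of_le l hl 0 m (Nat.zero_le _) R _ (DD_big l hl R hR1))
    · have hPr := hPsi.2.1 r hr1
      have hgp : 0 < r ^ betaZero l := by positivity
      refine finish9 _ _ _ _ (r ^ betaZero l) (R ^ betaZero l) hgp hGp
        (by rw [hPr]; linarith) (by rw [hPr]; linarith)
        (by rw [hPR]; linarith) (by rw [hPR]; linarith) ?_
      rw [← Real.div_rpow (by linarith) hr.le]
      have := rpow_sandwich l hl 0 (R / r) ((one_le_div hr).2 hrR)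
      exact ⟨le_rfl, this.1.trans this.2⟩
end
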